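/- arXiv:2102.12079 — 3 statements merged into one kernel-verified Lean document; each statement's English description precedes it below -/
import Mathlib

section
/- Let p ≥ 3 and n ≥ 1 be integers, b > 0, a = -2 so that π(g) = (g/(g+1))^b, and fix w > 0, s > 0 and integers i, j ≥ 1. Then (n/2+1)·w·∬ (g+1)^{-1} F(g,η;w,s) h_i(η)² π(g) k_j(g)² dg dη = (p/2-1)·∬ F(g,η;w,s) h_i(η)² π(g) k_j(g)² dg dη − 2w·∬ (g+1)^{-1} η F(g,η;w,s) h_i(η) h_i'(η) π(g) k_j(g)² dg dη − 2·∬ (g+1+w) F(g,η;w,s) h_i(η)² π(g) k_j(g) k_j'(g) dg dη − b·∬ ((g+1+w)/(g(g+1))) F(g,η;w,s) h_i(η)² π(g) k_j(g)² dg dη, where all double integrals are over g ∈ (0,∞), η ∈ (0,∞), h_i' denotes the derivative of h_i (which exists for η ≠ 1), and k_j' the derivative of k_j. -/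
open MeasureTheory Real Set

/-- The kernel `F(g,η;w,s)`. -/
noncomputable def Fker (p n : ℕ) (g η w s : ℝ) : ℝ :=
  η ^ ((p : ℝ) / 2 + (n : ℝ) / 2) * (g + 1) ^ (-(p : ℝ) / 2) *
    Real.exp (-(η * s / 2) * (w / (g + 1) + 1))

/-- The sequence `h_i(η) = i/(i + |log η|)`. -/
noncomputable def hfun (i : ℕ) (η : ℝ) : ℝ :=
  (i : ℝ) / ((i : ℝ) + |Real.log η|)

/-- The sequence `k_j(g) = 1 - log(g+1)/log(g+1+j)`. -/
noncomputable def kfun (j : ℕ) (g : ℝ) : ℝ :=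
  1 - Real.log (g + 1) / Real.log (g + 1 + (j : ℝ))

/-- The derivative of `hfun i` away from `η = 1`. -/
noncomputable def hfunDeriv (i : ℕ) (η : ℝ) : ℝ :=
  -((i : ℝ) * (Real.log η / |Real.log η|) / η) / ((i : ℝ) + |Real.log η|) ^ 2

/-- The derivative of `kfun j`. -/
noncomputable def kfunDeriv (j : ℕ) (g : ℝ) : ℝ :=
  -(Real.log (g + 1 + j) / (g + 1) - Real.log (g + 1) / (g + 1 + j)) /
    Real.log (g + 1 + j) ^ 2

lemma hfun_pos {i : ℕ} (hi : 1 ≤ i) (η : ℝ) : 0 < hfun i η := by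
  have : (0 : ℝ) < i := by exact_mod_cast hi
  unfold hfun
  positivity

lemma hfun_le_one {i : ℕ} (hi : 1 ≤ i) (η : ℝ) : hfun i η ≤ 1 := by
  have : (0 : ℝ) < i := by exact_mod_cast hi
  unfold hfun
  rw [div_le_one (by positivity)]
  linarith [abs_nonneg (Real.log η)]

lemma hasDerivAt_hfun {i : ℕ} (hi : 1 ≤ i) {η : ℝ} (hη : 0 < η) (hη1 : η ≠ 1) :
    HasDerivAt (hfun i) (hfunDeriv i η) η := by
  have hi0 : (0 : ℝ) < i := by exact_mod_cast hi
  have hlog : Real.log η ≠ 0 := Real.log_ne_zero_of_pos_of_ne_one hη hη1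
  have habs : HasDerivAt (fun x : ℝ => |x|) (Real.log η / |Real.log η|) (Real.log η) := by
    convert hasDerivAt_abs hlog using 1
    rcases lt_or_gt_of_ne hlog with h | h
    · rw [abs_of_neg h, sign_neg h, div_neg, div_self hlog]; simp
    · rw [abs_of_pos h, sign_pos h, div_self hlog]; simp
  have h1 := (habs.comp η (Real.hasDerivAt_log hη.ne')).const_add (i : ℝ)
  have h2 := (hasDerivAt_const η (i : ℝ)).div h1 (by simp; positivity)
  refine h2.congr_deriv ?_
  simp only [hfunDeriv, Function.comp_apply]
  ring

lemma abs_mul_hfunDeriv_le_one {i : ℕ} (hi : 1 ≤ i) {η : ℝ} (hη : 0 < η) :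
    |η * hfunDeriv i η| ≤ 1 := by
  have hi0 : (1 : ℝ) ≤ i := by exact_mod_cast hi
  have hq : |Real.log η / (|Real.log η|)| ≤ 1 := by
    rw [abs_div, abs_abs]
    exact div_self_le_one _
  have he : η * hfunDeriv i η =
      -((i : ℝ) * (Real.log η / |Real.log η|)) / ((i : ℝ) + |Real.log η|) ^ 2 := by
    unfold hfunDeriv
    field_simp
  have hpos : 0 < (i : ℝ) + |Real.log η| := by positivity
  rw [he, abs_div, abs_neg, abs_mul, abs_of_pos (pow_pos hpos 2), div_le_one (pow_pos hpos 2),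
    abs_of_nonneg (by positivity : (0 : ℝ) ≤ i)]
  have := abs_nonneg (Real.log η)
  nlinarith [mul_le_mul_of_nonneg_left hq (by positivity : (0 : ℝ) ≤ i)]

lemma half_lt_log {j : ℕ} (hj : 1 ≤ j) {g : ℝ} (hg : 0 ≤ g) : 1 / 2 < Real.log (g + 1 + j) := by
  have hj0 : (1 : ℝ) ≤ j := by exact_mod_cast hj
  have := Real.log_le_log (by norm_num : (0 : ℝ) < 2) (by linarith : 2 ≤ g + 1 + j)
  linarith [Real.log_two_gt_d9]

lemma log_add_one_le_log_add_one_add {j : ℕ} {g : ℝ} (hg : 0 ≤ g) :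
    Real.log (g + 1) ≤ Real.log (g + 1 + j) :=
  Real.log_le_log (by linarith) (by linarith [(Nat.cast_nonneg j : (0 : ℝ) ≤ j)])

lemma hasDerivAt_kfun {j : ℕ} (hj : 1 ≤ j) {g : ℝ} (hg : 0 ≤ g) :
    HasDerivAt (kfun j) (kfunDeriv j g) g := by
  have hj0 : (1 : ℝ) ≤ j := by exact_mod_cast hj
  have hL := half_lt_log hj hg
  have h1 : HasDerivAt (fun x : ℝ => Real.log (x + 1)) (1 / (g + 1)) g :=
    ((hasDerivAt_id g).add_const 1).log (by simp; linarith)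
  have h2 : HasDerivAt (fun x : ℝ => Real.log (x + 1 + j)) (1 / (g + 1 + j)) g :=
    (((hasDerivAt_id g).add_const 1).add_const (j : ℝ)).log (by simp; linarith)
  refine ((h1.div h2 (by linarith)).const_sub 1).congr_deriv ?_
  unfold kfunDeriv
  ring

lemma kfun_nonneg {j : ℕ} (hj : 1 ≤ j) {g : ℝ} (hg : 0 ≤ g) : 0 ≤ kfun j g := by
  have hL := half_lt_log hj hg
  unfold kfun
  rw [sub_nonneg, div_le_one (by linarith)]
  exact log_add_one_le_log_add_one_add hg

lemma kfun_le_one {j : ℕ} (hj : 1 ≤ j) {g : ℝ} (hg : 0 ≤ g) : kfun j g ≤ 1 := by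
  have hL := half_lt_log hj hg
  have : 0 ≤ Real.log (g + 1) / Real.log (g + 1 + j) :=
    div_nonneg (Real.log_nonneg (by linarith)) (by linarith)
  unfold kfun
  linarith

lemma add_one_mul_kfun_le {j : ℕ} (hj : 1 ≤ j) {g : ℝ} (hg : 0 ≤ g) :
    (g + 1) * kfun j g ≤ 2 * j := by
  have hj0 : (1 : ℝ) ≤ j := by exact_mod_cast hj
  have hL := half_lt_log hj hg
  have h1 : 0 < g + 1 := by linarith
  have hdiff : (g + 1) * (Real.log (g + 1 + j) - Real.log (g + 1)) ≤ j := by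
    rw [← Real.log_div (by linarith) h1.ne']
    have := Real.log_le_sub_one_of_pos (by positivity : 0 < (g + 1 + j) / (g + 1))
    calc _ ≤ (g + 1) * ((g + 1 + j) / (g + 1) - 1) := by gcongr
      _ = j := by field_simp; ring
  have he : (g + 1) * kfun j g =
      (g + 1) * (Real.log (g + 1 + j) - Real.log (g + 1)) / Real.log (g + 1 + j) := by
    unfold kfun
    field_simp
  rw [he, div_le_iff₀ (by linarith)]
  nlinarith

lemma add_mul_kfun_le {j : ℕ} (hj : 1 ≤ j) {g w : ℝ} (hg : 0 ≤ g) (hw : 0 ≤ w) :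
    (g + 1 + w) * kfun j g ≤ (1 + w) * (2 * j) := by
  have hk := kfun_nonneg hj hg
  calc (g + 1 + w) * kfun j g ≤ (1 + w) * ((g + 1) * kfun j g) := by
        nlinarith [mul_nonneg (mul_nonneg hw hg) hk]
    _ ≤ _ := mul_le_mul_of_nonneg_left (add_one_mul_kfun_le hj hg) (by linarith)

lemma abs_kfunDeriv_le {j : ℕ} (hj : 1 ≤ j) {g : ℝ} (hg : 0 ≤ g) : |kfunDeriv j g| ≤ 4 := by
  have hj0 : (1 : ℝ) ≤ j := by exact_mod_cast hj
  have hL := half_lt_log hj hg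
  have hl : 0 ≤ Real.log (g + 1) := Real.log_nonneg (by linarith)
  have hlL := log_add_one_le_log_add_one_add (j := j) hg
  have ha : Real.log (g + 1 + j) / (g + 1) ≤ Real.log (g + 1 + j) :=
    div_le_self (by linarith) (by linarith)
  have hb : Real.log (g + 1) / (g + 1 + j) ≤ Real.log (g + 1) :=
    div_le_self hl (by linarith)
  have ha' : 0 ≤ Real.log (g + 1 + j) / (g + 1) := div_nonneg (by linarith) (by linarith)
  have hb' : 0 ≤ Real.log (g + 1) / (g + 1 + j) := div_nonneg hl (by linarith)
  unfold kfunDeriv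
  rw [abs_div, abs_neg, abs_of_pos (by positivity : 0 < Real.log (g + 1 + j) ^ 2),
    div_le_iff₀ (by positivity), abs_le]
  constructor <;> nlinarith

lemma integral_Ioi_eq_zero_of_hasDerivAt_off_one {f f' : ℝ → ℝ} (hf0 : f 0 = 0)
    (hcont : ContinuousOn f (Ici 0)) (hderiv : ∀ x, 0 < x → x ≠ 1 → HasDerivAt f (f' x) x)
    (hint : IntegrableOn f' (Ioi 0)) (hlim : Filter.Tendsto f Filter.atTop (nhds 0)) :
    ∫ x in Ioi 0, f' x = 0 := by
  have h1 : IntegrableOn f' (Ioc 0 1) := hint.mono_set Ioc_subset_Ioi_self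
  have h2 : IntegrableOn f' (Ioi 1) := hint.mono_set (Ioi_subset_Ioi zero_le_one)
  have e1 : ∫ x in Ioc 0 1, f' x = f 1 - f 0 := by
    rw [← intervalIntegral.integral_of_le zero_le_one]
    refine intervalIntegral.integral_eq_sub_of_hasDerivAt_of_le zero_le_one
      (hcont.mono Icc_subset_Ici_self) (fun x hx => hderiv x hx.1 hx.2.ne) ?_
    rwa [intervalIntegrable_iff_integrableOn_Ioc_of_le zero_le_one]
  have e2 : ∫ x in Ioi 1, f' x = 0 - f 1 :=
    integral_Ioi_of_hasDerivAt_of_tendsto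
      ((hcont 1 (by simp)).mono (Ici_subset_Ici.2 zero_le_one))
      (fun x hx => hderiv x (zero_lt_one.trans hx) (ne_of_gt hx)) h2 hlim
  rw [← Ioc_union_Ioi_eq_Ioi (zero_le_one : (0 : ℝ) ≤ 1),
    setIntegral_union (Ioc_disjoint_Ioi le_rfl) measurableSet_Ioi h1 h2, e1, e2, hf0]
  ring

lemma hasDerivAt_div_add_one_rpow (b : ℝ) {g : ℝ} (hg : 0 < g) :
    HasDerivAt (fun x : ℝ => (x / (x + 1)) ^ b) (b * ((g / (g + 1)) ^ b / (g * (g + 1)))) g := by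
  have h1 : HasDerivAt (fun x : ℝ => x / (x + 1)) ((1 * (g + 1) - g * 1) / (g + 1) ^ 2) g :=
    (hasDerivAt_id g).div ((hasDerivAt_id g).add_const 1) (by simp; linarith)
  have hpos : 0 < g / (g + 1) := by positivity
  convert h1.rpow_const (p := b) (Or.inl hpos.ne') using 1
  rw [Real.rpow_sub_one hpos.ne']
  field_simp
  ring

lemma continuousOn_div_add_one_rpow {b : ℝ} (hb : 0 ≤ b) :
    ContinuousOn (fun x : ℝ => (x / (x + 1)) ^ b) (Ici 0) := by
  refine ContinuousOn.rpow_const (ContinuousOn.div (by fun_prop) (by fun_prop) ?_)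
    (fun _ _ => Or.inr hb)
  intro x hx
  have : (0 : ℝ) ≤ x := hx
  positivity

lemma div_add_one_rpow_mem_Icc {b g : ℝ} (hb : 0 ≤ b) (hg : 0 ≤ g) :
    (g / (g + 1)) ^ b ∈ Icc (0 : ℝ) 1 :=
  ⟨by positivity, Real.rpow_le_one (by positivity)
    ((div_le_one (by linarith)).2 (by linarith)) hb⟩

lemma integrableOn_div_add_one_rpow_div {b : ℝ} (hb : 0 < b) :
    IntegrableOn (fun g : ℝ => (g / (g + 1)) ^ b / (g * (g + 1))) (Ioi 0) := by
  have hlim : Filter.Tendsto (fun x : ℝ => (x / (x + 1)) ^ b) Filter.atTop (nhds (1 ^ b)) := by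
    have h : Filter.Tendsto (fun x : ℝ => x / (x + 1)) Filter.atTop (nhds 1) := by
      have h0 : Filter.Tendsto (fun x : ℝ => 1 - (x + 1)⁻¹) Filter.atTop (nhds (1 - 0)) :=
        tendsto_const_nhds.sub (tendsto_inv_atTop_zero.comp
          (Filter.tendsto_atTop_add_const_right _ 1 Filter.tendsto_id))
      rw [sub_zero] at h0
      refine h0.congr' ?_
      filter_upwards [Filter.eventually_gt_atTop 0] with x hx
      field_simp
      ring
    exact h.rpow_const (Or.inl one_ne_zero)
  have h := integrableOn_Ioi_deriv_of_nonneg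
    (continuousOn_div_add_one_rpow hb.le 0 self_mem_Ici)
    (fun x hx => hasDerivAt_div_add_one_rpow b hx)
    (fun x hx => by have : (0 : ℝ) < x := hx; positivity) hlim
  have h' := h.const_mul b⁻¹
  refine h'.congr (Filter.Eventually.of_forall fun x => ?_)
  field_simp

lemma measurable_hfun (i : ℕ) : Measurable (hfun i) := by
  unfold hfun
  fun_prop

lemma measurable_hfunDeriv (i : ℕ) : Measurable (hfunDeriv i) := by
  unfold hfunDeriv
  fun_prop

lemma measurable_kfun (j : ℕ) : Measurable (kfun j) := by
  unfold kfun
  fun_prop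

lemma measurable_kfunDeriv (j : ℕ) : Measurable (kfunDeriv j) := by
  unfold kfunDeriv
  fun_prop

lemma measurable_Fker (p n : ℕ) (w s : ℝ) :
    Measurable (fun z : ℝ × ℝ => Fker p n z.1 z.2 w s) := by
  unfold Fker
  fun_prop

lemma Fker_nonneg (p n : ℕ) {g η : ℝ} (hg : 0 ≤ g) (hη : 0 ≤ η) (w s : ℝ) :
    0 ≤ Fker p n g η w s := by
  unfold Fker
  positivity

lemma Fker_le {p : ℕ} (hp : 3 ≤ p) (n : ℕ) {g η w s : ℝ} (hg : 0 ≤ g) (hη : 0 ≤ η)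
    (hw : 0 ≤ w) (hs : 0 ≤ s) :
    Fker p n g η w s ≤ (g + 1) ^ (-(3 / 2) : ℝ) *
      (η ^ ((p : ℝ) / 2 + (n : ℝ) / 2) * Real.exp (-(s / 2) * η ^ (1 : ℝ))) := by
  have hp' : (3 : ℝ) ≤ p := by exact_mod_cast hp
  have h1 : (g + 1) ^ (-(p : ℝ) / 2) ≤ (g + 1) ^ (-(3 / 2) : ℝ) :=
    Real.rpow_le_rpow_of_exponent_le (by linarith) (by linarith)
  have h2 : Real.exp (-(η * s / 2) * (w / (g + 1) + 1)) ≤ Real.exp (-(s / 2) * η ^ (1 : ℝ)) := by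
    rw [Real.rpow_one]
    refine Real.exp_le_exp.2 ?_
    have : 0 ≤ (η * s / 2) * (w / (g + 1)) := by positivity
    linarith
  calc Fker p n g η w s ≤ η ^ ((p : ℝ) / 2 + (n : ℝ) / 2) * (g + 1) ^ (-(3 / 2) : ℝ) *
        Real.exp (-(s / 2) * η ^ (1 : ℝ)) := by unfold Fker; gcongr
    _ = _ := by ring

lemma Fker_le_rpow_mul_exp {p : ℕ} (hp : 3 ≤ p) (n : ℕ) {g η w s : ℝ} (hg : 0 ≤ g) (hη : 0 ≤ η)
    (hw : 0 ≤ w) (hs : 0 ≤ s) :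
    Fker p n g η w s ≤
      η ^ ((p : ℝ) / 2 + (n : ℝ) / 2) * Real.exp (-(s / 2) * η ^ (1 : ℝ)) := by
  refine (Fker_le hp n hg hη hw hs).trans (mul_le_of_le_one_left (by positivity) ?_)
  exact Real.rpow_le_one_of_one_le_of_nonpos (by linarith) (by norm_num)

lemma hasDerivAt_Fker_right (p n : ℕ) (g w s : ℝ) {η : ℝ} (hη : 0 < η) :
    HasDerivAt (fun x => Fker p n g x w s)
      (Fker p n g η w s *
        (((p : ℝ) / 2 + (n : ℝ) / 2) / η - s / 2 * (w / (g + 1) + 1))) η := by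
  have h1 := Real.hasDerivAt_rpow_const (p := (p : ℝ) / 2 + (n : ℝ) / 2) (Or.inl hη.ne')
  have h2 : HasDerivAt (fun x : ℝ => -(x * s / 2) * (w / (g + 1) + 1))
      (-(1 * s / 2) * (w / (g + 1) + 1)) η :=
    ((((hasDerivAt_id η).mul_const s).div_const 2).neg).mul_const _
  refine ((h1.mul_const ((g + 1) ^ (-(p : ℝ) / 2))).mul h2.exp).congr_deriv ?_
  rw [Real.rpow_sub_one hη.ne']
  unfold Fker
  ring

lemma hasDerivAt_Fker_left (p n : ℕ) (η w s : ℝ) {g : ℝ} (hg : 0 < g) :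
    HasDerivAt (fun x => Fker p n x η w s)
      (Fker p n g η w s *
        (-(p : ℝ) / 2 / (g + 1) + η * s / 2 * (w / (g + 1) ^ 2))) g := by
  have hg1 : g + 1 ≠ 0 := by positivity
  have h0 : HasDerivAt (fun x : ℝ => x + 1) 1 g := (hasDerivAt_id g).add_const 1
  have h1 := h0.rpow_const (p := -(p : ℝ) / 2) (Or.inl hg1)
  have h2 : HasDerivAt (fun x : ℝ => -(η * s / 2) * (w / (x + 1) + 1))
      (-(η * s / 2) * ((0 * (g + 1) - w * 1) / (g + 1) ^ 2)) g :=
    (((hasDerivAt_const g w).div h0 hg1).add_const 1).const_mul _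
  refine ((h1.const_mul (η ^ ((p : ℝ) / 2 + (n : ℝ) / 2))).mul h2.exp).congr_deriv ?_
  rw [Real.rpow_sub_one hg1]
  unfold Fker
  ring

lemma ae_prod_restrict_Ioi :
    ∀ᵐ z ∂((volume.restrict (Ioi (0 : ℝ))).prod (volume.restrict (Ioi (0 : ℝ)))),
      0 < z.1 ∧ 0 < z.2 := by
  rw [Measure.prod_restrict]
  exact ae_restrict_mem (measurableSet_Ioi.prod measurableSet_Ioi)

lemma integrable_prod_of_abs_le {u v : ℝ → ℝ} {T : ℝ × ℝ → ℝ} (hu : IntegrableOn u (Ioi 0))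
    (hv : IntegrableOn v (Ioi 0)) (hT : Measurable T) (K : ℝ)
    (hb : ∀ g η, 0 < g → 0 < η → |T (g, η)| ≤ K * (u g * v η)) :
    Integrable T ((volume.restrict (Ioi (0 : ℝ))).prod (volume.restrict (Ioi (0 : ℝ)))) := by
  refine Integrable.mono' ((Integrable.mul_prod hu hv).const_mul K) hT.aestronglyMeasurable ?_
  filter_upwards [ae_prod_restrict_Ioi] with z hz
  exact hb z.1 z.2 hz.1 hz.2

lemma integrableOn_rpow_mul_exp {m s : ℝ} (hm : 0 ≤ m) (hs : 0 < s) :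
    IntegrableOn (fun η : ℝ => η ^ m * Real.exp (-(s / 2) * η ^ (1 : ℝ))) (Ioi 0) :=
  integrableOn_rpow_mul_exp_neg_mul_rpow (by linarith) one_pos (by linarith)

lemma integrableOn_add_one_rpow :
    IntegrableOn (fun g : ℝ => (g + 1) ^ (-(3 / 2) : ℝ)) (Ioi 0) :=
  integrableOn_add_rpow_Ioi_of_lt (by norm_num) (by norm_num)

/-- Absolute integrability of a bounded multiple of `Fker`. -/
lemma integrable_mul_Fker {p : ℕ} (hp : 3 ≤ p) (n : ℕ) {w s : ℝ} (hw : 0 ≤ w) (hs : 0 < s)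
    {B T : ℝ × ℝ → ℝ} (hT : Measurable T) {K : ℝ}
    (hTB : ∀ z, T z = B z * Fker p n z.1 z.2 w s)
    (hB : ∀ g η, 0 < g → 0 < η → |B (g, η)| ≤ K) :
    Integrable T ((volume.restrict (Ioi (0 : ℝ))).prod (volume.restrict (Ioi (0 : ℝ)))) := by
  refine integrable_prod_of_abs_le integrableOn_add_one_rpow
    (integrableOn_rpow_mul_exp (m := (p : ℝ) / 2 + (n : ℝ) / 2) (by positivity) hs) hT K ?_
  intro g η hg hη
  have hF := Fker_nonneg p n hg.le hη.le w s
  rw [hTB, abs_mul, abs_of_nonneg hF]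
  exact mul_le_mul (hB g η hg hη) (Fker_le hp n hg.le hη.le hw hs.le) hF
    ((abs_nonneg _).trans (hB g η hg hη))

section Integrability

variable {p n i j : ℕ} {b w s : ℝ}

lemma weight_mem_Icc (hi : 1 ≤ i) (hj : 1 ≤ j) (hb : 0 ≤ b) {g : ℝ} (hg : 0 ≤ g) (η : ℝ) :
    hfun i η ^ 2 * (g / (g + 1)) ^ b * kfun j g ^ 2 ∈ Icc (0 : ℝ) 1 := by
  have hh := hfun_pos hi η
  have hk := kfun_nonneg hj hg
  obtain ⟨hπ0, hπ1⟩ := div_add_one_rpow_mem_Icc hb hg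
  exact ⟨by positivity, mul_le_one₀ (mul_le_one₀ (pow_le_one₀ hh.le (hfun_le_one hi η)) hπ0 hπ1)
    (by positivity) (pow_le_one₀ hk (kfun_le_one hj hg))⟩

lemma integrable_base (hp : 3 ≤ p) (n : ℕ) (hb : 0 ≤ b) (hw : 0 ≤ w) (hs : 0 < s)
    (hi : 1 ≤ i) (hj : 1 ≤ j) :
    Integrable (fun z : ℝ × ℝ => Fker p n z.1 z.2 w s * hfun i z.2 ^ 2 *
        (z.1 / (z.1 + 1)) ^ b * kfun j z.1 ^ 2)
      ((volume.restrict (Ioi (0 : ℝ))).prod (volume.restrict (Ioi (0 : ℝ)))) := by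
  have := measurable_Fker p n w s
  have := measurable_hfun i
  have := measurable_kfun j
  refine integrable_mul_Fker hp n hw hs (K := 1) (by fun_prop)
    (B := fun z => hfun i z.2 ^ 2 * (z.1 / (z.1 + 1)) ^ b * kfun j z.1 ^ 2)
    (fun z => by ring) fun g η hg hη => ?_
  obtain ⟨h0, h1⟩ := weight_mem_Icc hi hj hb hg.le η
  rwa [abs_of_nonneg h0]

lemma integrable_inv_mul_base (hp : 3 ≤ p) (n : ℕ) (hb : 0 ≤ b) (hw : 0 ≤ w) (hs : 0 < s)
    (hi : 1 ≤ i) (hj : 1 ≤ j) :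
    Integrable (fun z : ℝ × ℝ => (z.1 + 1)⁻¹ * Fker p n z.1 z.2 w s * hfun i z.2 ^ 2 *
        (z.1 / (z.1 + 1)) ^ b * kfun j z.1 ^ 2)
      ((volume.restrict (Ioi (0 : ℝ))).prod (volume.restrict (Ioi (0 : ℝ)))) := by
  have := measurable_Fker p n w s
  have := measurable_hfun i
  have := measurable_kfun j
  refine integrable_mul_Fker hp n hw hs (K := 1) (by fun_prop)
    (B := fun z => (z.1 + 1)⁻¹ * (hfun i z.2 ^ 2 * (z.1 / (z.1 + 1)) ^ b * kfun j z.1 ^ 2))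
    (fun z => by ring) fun g η hg hη => ?_
  obtain ⟨h0, h1⟩ := weight_mem_Icc hi hj hb hg.le η
  have h2 : (g + 1)⁻¹ ≤ 1 := inv_le_one_of_one_le₀ (by linarith)
  simp only
  rw [abs_of_nonneg (mul_nonneg (by positivity) h0)]
  exact mul_le_one₀ h2 h0 h1

lemma integrable_hfunDeriv_term (hp : 3 ≤ p) (n : ℕ) (hb : 0 ≤ b) (hw : 0 ≤ w) (hs : 0 < s)
    (hi : 1 ≤ i) (hj : 1 ≤ j) :
    Integrable (fun z : ℝ × ℝ => (z.1 + 1)⁻¹ * z.2 * Fker p n z.1 z.2 w s *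
        (hfun i z.2 * hfunDeriv i z.2) * (z.1 / (z.1 + 1)) ^ b * kfun j z.1 ^ 2)
      ((volume.restrict (Ioi (0 : ℝ))).prod (volume.restrict (Ioi (0 : ℝ)))) := by
  have := measurable_Fker p n w s
  have := measurable_hfun i
  have := measurable_hfunDeriv i
  have := measurable_kfun j
  refine integrable_mul_Fker hp n hw hs (K := 1) (by fun_prop)
    (B := fun z => (z.2 * hfunDeriv i z.2) *
      ((z.1 + 1)⁻¹ * hfun i z.2 * (z.1 / (z.1 + 1)) ^ b * kfun j z.1 ^ 2))
    (fun z => by ring) fun g η hg hη => ?_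
  have hh := hfun_pos hi η
  have hk := kfun_nonneg hj hg.le
  obtain ⟨hπ0, hπ1⟩ := div_add_one_rpow_mem_Icc hb hg.le
  have h2 : (g + 1)⁻¹ ≤ 1 := inv_le_one_of_one_le₀ (by linarith)
  have h0 : 0 ≤ (g + 1)⁻¹ * hfun i η * (g / (g + 1)) ^ b * kfun j g ^ 2 := by positivity
  have h1 : (g + 1)⁻¹ * hfun i η * (g / (g + 1)) ^ b * kfun j g ^ 2 ≤ 1 :=
    mul_le_one₀ (mul_le_one₀ (mul_le_one₀ h2 hh.le (hfun_le_one hi η)) hπ0 hπ1)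
      (by positivity) (pow_le_one₀ hk (kfun_le_one hj hg.le))
  simp only
  rw [abs_mul, abs_of_nonneg h0]
  exact mul_le_one₀ (abs_mul_hfunDeriv_le_one hi hη) h0 h1

lemma integrable_kfunDeriv_term (hp : 3 ≤ p) (n : ℕ) (hb : 0 ≤ b) (hw : 0 ≤ w) (hs : 0 < s)
    (hi : 1 ≤ i) (hj : 1 ≤ j) :
    Integrable (fun z : ℝ × ℝ => (z.1 + 1 + w) * Fker p n z.1 z.2 w s * hfun i z.2 ^ 2 *
        (z.1 / (z.1 + 1)) ^ b * (kfun j z.1 * kfunDeriv j z.1))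
      ((volume.restrict (Ioi (0 : ℝ))).prod (volume.restrict (Ioi (0 : ℝ)))) := by
  have := measurable_Fker p n w s
  have := measurable_hfun i
  have := measurable_kfunDeriv j
  have := measurable_kfun j
  refine integrable_mul_Fker hp n hw hs (K := (1 + w) * (2 * j) * 4 * 1) (by fun_prop)
    (B := fun z => ((z.1 + 1 + w) * kfun j z.1) * kfunDeriv j z.1 *
      (hfun i z.2 ^ 2 * (z.1 / (z.1 + 1)) ^ b))
    (fun z => by ring) fun g η hg hη => ?_
  have hh := hfun_pos hi η
  have hk := kfun_nonneg hj hg.le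
  obtain ⟨hπ0, hπ1⟩ := div_add_one_rpow_mem_Icc hb hg.le
  have h0 : 0 ≤ hfun i η ^ 2 * (g / (g + 1)) ^ b := by positivity
  have h1 : hfun i η ^ 2 * (g / (g + 1)) ^ b ≤ 1 :=
    mul_le_one₀ (pow_le_one₀ hh.le (hfun_le_one hi η)) hπ0 hπ1
  have h2 : 0 ≤ (g + 1 + w) * kfun j g := by positivity
  simp only
  rw [abs_mul, abs_mul, abs_of_nonneg h0, abs_of_nonneg h2]
  exact mul_le_mul (mul_le_mul (add_mul_kfun_le hj hg.le hw) (abs_kfunDeriv_le hj hg.le)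
    (abs_nonneg _) (by positivity)) h1 h0 (by positivity)

lemma integrable_prior_deriv_term (hp : 3 ≤ p) (n : ℕ) (hb : 0 < b) (hw : 0 ≤ w) (hs : 0 < s)
    (hi : 1 ≤ i) (hj : 1 ≤ j) :
    Integrable (fun z : ℝ × ℝ => ((z.1 + 1 + w) / (z.1 * (z.1 + 1))) * Fker p n z.1 z.2 w s *
        hfun i z.2 ^ 2 * (z.1 / (z.1 + 1)) ^ b * kfun j z.1 ^ 2)
      ((volume.restrict (Ioi (0 : ℝ))).prod (volume.restrict (Ioi (0 : ℝ)))) := by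
  have := measurable_Fker p n w s
  have := measurable_hfun i
  have := measurable_kfun j
  refine integrable_prod_of_abs_le (integrableOn_div_add_one_rpow_div hb)
    (integrableOn_rpow_mul_exp (m := (p : ℝ) / 2 + (n : ℝ) / 2) (by positivity) hs)
    (by fun_prop) ((1 + w) * (2 * j) * 1) fun g η hg hη => ?_
  have hh := hfun_pos hi η
  have hk := kfun_nonneg hj hg.le
  have hF := Fker_nonneg p n hg.le hη.le w s
  have h1 : hfun i η ^ 2 * kfun j g ≤ 1 :=
    mul_le_one₀ (pow_le_one₀ hh.le (hfun_le_one hi η)) hk (kfun_le_one hj hg.le)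
  simp only
  rw [abs_of_nonneg (by positivity)]
  calc _ = ((g + 1 + w) * kfun j g) * (hfun i η ^ 2 * kfun j g) *
        ((g / (g + 1)) ^ b / (g * (g + 1)) * Fker p n g η w s) := by ring
    _ ≤ _ := mul_le_mul (mul_le_mul (add_mul_kfun_le hj hg.le hw) h1 (by positivity)
        (by positivity)) (mul_le_mul_of_nonneg_left
          (Fker_le_rpow_mul_exp hp n hg.le hη.le hw hs.le) (by positivity))
        (by positivity) (by positivity)

lemma integrable_exponent_term (hp : 3 ≤ p) (n : ℕ) (hb : 0 ≤ b) (hw : 0 ≤ w) (hs : 0 < s)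
    (hi : 1 ≤ i) (hj : 1 ≤ j) :
    Integrable (fun z : ℝ × ℝ => z.2 * s / 2 * (w / (z.1 + 1) + 1) * (w / (z.1 + 1)) *
        (Fker p n z.1 z.2 w s * hfun i z.2 ^ 2 * (z.1 / (z.1 + 1)) ^ b * kfun j z.1 ^ 2))
      ((volume.restrict (Ioi (0 : ℝ))).prod (volume.restrict (Ioi (0 : ℝ)))) := by
  have := measurable_Fker p n w s
  have := measurable_hfun i
  have := measurable_kfun j
  refine integrable_prod_of_abs_le integrableOn_add_one_rpow
    (integrableOn_rpow_mul_exp (m := (p : ℝ) / 2 + (n : ℝ) / 2 + 1) (by positivity) hs)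
    (by fun_prop) (s / 2 * ((w + 1) * w) * 1) fun g η hg hη => ?_
  obtain ⟨h0, h1⟩ := weight_mem_Icc hi hj hb hg.le η
  have hk := kfun_nonneg hj hg.le
  have hF := Fker_nonneg p n hg.le hη.le w s
  have hwg : w / (g + 1) ≤ w := div_le_self hw (by linarith)
  simp only
  rw [abs_of_nonneg (by positivity), Real.rpow_add_one hη.ne']
  calc _ = s / 2 * ((w / (g + 1) + 1) * (w / (g + 1))) *
        (hfun i η ^ 2 * (g / (g + 1)) ^ b * kfun j g ^ 2) * (η * Fker p n g η w s) := by ring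
    _ ≤ s / 2 * ((w + 1) * w) * 1 * (η * ((g + 1) ^ (-(3 / 2) : ℝ) *
      (η ^ ((p : ℝ) / 2 + (n : ℝ) / 2) * Real.exp (-(s / 2) * η ^ (1 : ℝ))))) := by
        gcongr
        exact Fker_le hp n hg.le hη.le hw hs.le
    _ = _ := by ring

end Integrability

lemma tendsto_Fker_atTop_right (p n : ℕ) {g w s : ℝ} (hg : 0 ≤ g) (hw : 0 ≤ w) (hs : 0 < s) :
    Filter.Tendsto (fun η => η * Fker p n g η w s) Filter.atTop (nhds 0) := by
  have hA : 0 < s / 2 * (w / (g + 1) + 1) := by positivity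
  have h := (tendsto_rpow_mul_exp_neg_mul_atTop_nhds_zero
    ((p : ℝ) / 2 + (n : ℝ) / 2 + 1) _ hA).const_mul ((g + 1) ^ (-(p : ℝ) / 2))
  rw [mul_zero] at h
  refine h.congr' ?_
  filter_upwards [Filter.eventually_gt_atTop 0] with η hη
  have he : -(η * s / 2) * (w / (g + 1) + 1) = -(s / 2 * (w / (g + 1) + 1)) * η := by ring
  rw [Real.rpow_add_one hη.ne', Fker, he]
  ring

/-- Integrating in `η`: the `η`-derivative of `η F h²` integrates to zero. -/
lemma integral_eta_eq_zero {p n i : ℕ} (hp : 3 ≤ p) (hi : 1 ≤ i) {g w s : ℝ}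
    (hg : 0 < g) (hw : 0 ≤ w) (hs : 0 < s) (C : ℝ) {f' : ℝ → ℝ}
    (hf' : ∀ η, 0 < η → f' η = C * (((p : ℝ) / 2 + (n : ℝ) / 2 + 1) * (Fker p n g η w s *
      hfun i η ^ 2) + 2 * (η * Fker p n g η w s * (hfun i η * hfunDeriv i η)) -
      η * s / 2 * (w / (g + 1) + 1) * (Fker p n g η w s * hfun i η ^ 2)))
    (hint : IntegrableOn f' (Ioi 0)) : ∫ η in Ioi 0, f' η = 0 := by
  have hp0 : (3 : ℝ) ≤ p := by exact_mod_cast hp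
  have hbound : ∀ η, 0 ≤ η → ‖C * (η * Fker p n g η w s * hfun i η ^ 2)‖ ≤
      |C| * (η * Fker p n g η w s) := by
    intro η hη
    have hF := Fker_nonneg p n hg.le hη w s
    have hh := hfun_pos hi η
    rw [Real.norm_eq_abs, abs_mul, abs_of_nonneg (by positivity :
      0 ≤ η * Fker p n g η w s * hfun i η ^ 2)]
    exact mul_le_mul_of_nonneg_left (mul_le_of_le_one_right (by positivity)
      (pow_le_one₀ hh.le (hfun_le_one hi η))) (abs_nonneg _)
  have hderiv : ∀ η, 0 < η → η ≠ 1 →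
      HasDerivAt (fun η => C * (η * Fker p n g η w s * hfun i η ^ 2)) (f' η) η := by
    intro η hη hη1
    refine ((((hasDerivAt_id η).mul (hasDerivAt_Fker_right p n g w s hη)).mul
      ((hasDerivAt_hfun hi hη hη1).pow 2)).const_mul C).congr_deriv ?_
    rw [hf' η hη]
    simp only [id, Pi.mul_apply, Pi.pow_apply]
    field_simp
    push_cast
    ring
  refine integral_Ioi_eq_zero_of_hasDerivAt_off_one (by simp) ?_ hderiv hint ?_
  · intro η hη
    rcases (mem_Ici.1 hη).eq_or_lt with rfl | hη
    · have hc : ContinuousAt (fun η => |C| * (η * Fker p n g η w s)) 0 := by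
        have : ContinuousAt (fun η : ℝ => η ^ ((p : ℝ) / 2 + (n : ℝ) / 2)) 0 :=
          Real.continuousAt_rpow_const _ _ (Or.inr (by positivity))
        unfold Fker
        fun_prop
      have hc' := hc.continuousWithinAt (s := Ici 0)
      simp only [ContinuousWithinAt, zero_mul, mul_zero] at hc' ⊢
      exact squeeze_zero_norm' (by filter_upwards [self_mem_nhdsWithin] with x hx
                                   exact hbound x hx) hc'
    · refine ContinuousAt.continuousWithinAt ?_
      have h1 := (hasDerivAt_Fker_right p n g w s hη).continuousAt
      have h2 : ContinuousAt (hfun i) η := by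
        have hi0 : (0 : ℝ) < i := by exact_mod_cast hi
        exact continuousAt_const.div (continuousAt_const.add (Real.continuousAt_log hη.ne').abs)
          (by positivity)
      fun_prop
  · have h := (tendsto_Fker_atTop_right p n hg.le hw hs).const_mul |C|
    rw [mul_zero] at h
    exact squeeze_zero_norm' (by filter_upwards [Filter.eventually_ge_atTop 0] with x hx
                                 exact hbound x hx) h

/-- Integrating in `g`: the `g`-derivative of `(g + 1 + w) F π k²` integrates to zero. -/
lemma integral_g_eq_zero {p n j : ℕ} (hp : 3 ≤ p) (hj : 1 ≤ j) {b η w s : ℝ} (hb : 0 < b)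
    (hη : 0 < η) (hw : 0 ≤ w) (hs : 0 < s) (C : ℝ) {f' : ℝ → ℝ}
    (hf' : ∀ g, 0 < g → f' g = C * (Fker p n g η w s * (g / (g + 1)) ^ b * kfun j g ^ 2 *
      (1 - (p : ℝ) / 2 - (p : ℝ) / 2 * w * (g + 1)⁻¹ +
        η * s / 2 * (w / (g + 1) + 1) * (w / (g + 1)) + b * ((g + 1 + w) / (g * (g + 1)))) +
      2 * ((g + 1 + w) * Fker p n g η w s * (g / (g + 1)) ^ b * (kfun j g * kfunDeriv j g))))
    (hint : IntegrableOn f' (Ioi 0)) : ∫ g in Ioi 0, f' g = 0 := by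
  have hderiv : ∀ g, 0 < g → HasDerivAt
      (fun g => C * ((g + 1 + w) * Fker p n g η w s * (g / (g + 1)) ^ b * kfun j g ^ 2))
      (f' g) g := by
    intro g hg
    refine (((((((hasDerivAt_id g).add_const 1).add_const w).mul
      (hasDerivAt_Fker_left p n η w s hg)).mul (hasDerivAt_div_add_one_rpow b hg)).mul
      ((hasDerivAt_kfun hj hg.le).pow 2)).const_mul C).congr_deriv ?_
    rw [hf' g hg]
    simp only [id, Pi.mul_apply, Pi.pow_apply]
    field_simp
    push_cast
    ring
  refine integral_Ioi_eq_zero_of_hasDerivAt_off_one (by simp [Real.zero_rpow hb.ne']) ?_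
    (fun g hg _ => hderiv g hg) hint ?_
  · refine continuousOn_const.mul (((ContinuousOn.mul (by fun_prop) ?_).mul
      (continuousOn_div_add_one_rpow hb.le)).mul (ContinuousOn.pow ?_ 2))
    · unfold Fker
      have hne : ∀ x ∈ Ici (0 : ℝ), x + 1 ≠ 0 := fun x hx => by
        have : (0 : ℝ) ≤ x := hx
        positivity
      have h1 : ContinuousOn (fun x : ℝ => (x + 1) ^ (-(p : ℝ) / 2)) (Ici 0) :=
        ContinuousOn.rpow_const (by fun_prop) fun x hx => Or.inl (hne x hx)
      have h2 : ContinuousOn (fun x : ℝ => w / (x + 1)) (Ici 0) :=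
        continuousOn_const.div (by fun_prop) hne
      fun_prop
    · exact fun g hg => (hasDerivAt_kfun hj hg).continuousAt.continuousWithinAt
  · set v := η ^ ((p : ℝ) / 2 + (n : ℝ) / 2) * Real.exp (-(s / 2) * η ^ (1 : ℝ)) with hv
    have hdecay : Filter.Tendsto (fun g : ℝ => |C| * ((1 + w) * (2 * j) *
        ((g + 1) ^ (-(3 / 2) : ℝ) * v))) Filter.atTop (nhds 0) := by
      have h := ((tendsto_rpow_neg_atTop (by norm_num : (0 : ℝ) < 3 / 2)).comp
        (Filter.tendsto_atTop_add_const_right _ (1 : ℝ) Filter.tendsto_id)).mul_const v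
      simpa using (h.const_mul ((1 + w) * (2 * j))).const_mul |C|
    refine squeeze_zero_norm' ?_ hdecay
    filter_upwards [Filter.eventually_ge_atTop 0] with g hg
    have hF := Fker_nonneg p n hg hη.le w s
    have hk := kfun_nonneg hj hg
    obtain ⟨hπ0, hπ1⟩ := div_add_one_rpow_mem_Icc hb.le hg
    have h1 : (g / (g + 1)) ^ b * kfun j g ≤ 1 := mul_le_one₀ hπ1 hk (kfun_le_one hj hg)
    rw [Real.norm_eq_abs, abs_mul, abs_of_nonneg (by positivity :
      0 ≤ (g + 1 + w) * Fker p n g η w s * (g / (g + 1)) ^ b * kfun j g ^ 2)]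
    refine mul_le_mul_of_nonneg_left ?_ (abs_nonneg C)
    calc _ = ((g + 1 + w) * kfun j g) * Fker p n g η w s * ((g / (g + 1)) ^ b * kfun j g) := by
          ring
      _ ≤ ((g + 1 + w) * kfun j g) * Fker p n g η w s :=
          mul_le_of_le_one_right (by positivity) h1
      _ ≤ _ := mul_le_mul (add_mul_kfun_le hj hg hw) (Fker_le hp n hg hη.le hw hs.le) hF
          (by positivity)

/-- Integration-by-parts identity for `a = -2`, `b > 0`
(Lemma on the representation of `(n/2+1) φ_{ij}`). -/
theorem integration_by_parts_identity (p n : ℕ) (hp : 3 ≤ p) (hn : 1 ≤ n)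
    (b : ℝ) (hb : 0 < b) (w s : ℝ) (hw : 0 < w) (hs : 0 < s)
    (i j : ℕ) (hi : 1 ≤ i) (hj : 1 ≤ j)
    (hi' : ℝ → ℝ) (hhi' : ∀ η : ℝ, 0 < η → η ≠ 1 → HasDerivAt (hfun i) (hi' η) η)
    (kj' : ℝ → ℝ) (hkj' : ∀ g : ℝ, 0 ≤ g → HasDerivAt (kfun j) (kj' g) g) :
    ((n : ℝ) / 2 + 1) * w *
      (∫ g in Ioi (0 : ℝ), ∫ η in Ioi (0 : ℝ),
        (g + 1)⁻¹ * Fker p n g η w s * (hfun i η) ^ 2 * (g / (g + 1)) ^ b * (kfun j g) ^ 2)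
    = ((p : ℝ) / 2 - 1) *
        (∫ g in Ioi (0 : ℝ), ∫ η in Ioi (0 : ℝ),
          Fker p n g η w s * (hfun i η) ^ 2 * (g / (g + 1)) ^ b * (kfun j g) ^ 2)
      - 2 * w *
        (∫ g in Ioi (0 : ℝ), ∫ η in Ioi (0 : ℝ),
          (g + 1)⁻¹ * η * Fker p n g η w s * (hfun i η * hi' η) * (g / (g + 1)) ^ b *
            (kfun j g) ^ 2)
      - 2 *
        (∫ g in Ioi (0 : ℝ), ∫ η in Ioi (0 : ℝ),
          (g + 1 + w) * Fker p n g η w s * (hfun i η) ^ 2 * (g / (g + 1)) ^ b *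
            (kfun j g * kj' g))
      - b *
        (∫ g in Ioi (0 : ℝ), ∫ η in Ioi (0 : ℝ),
          ((g + 1 + w) / (g * (g + 1))) * Fker p n g η w s * (hfun i η) ^ 2 *
            (g / (g + 1)) ^ b * (kfun j g) ^ 2) := by
  have e2 : (∫ g in Ioi (0 : ℝ), ∫ η in Ioi (0 : ℝ),
      (g + 1)⁻¹ * η * Fker p n g η w s * (hfun i η * hi' η) * (g / (g + 1)) ^ b *
        (kfun j g) ^ 2) = ∫ g in Ioi (0 : ℝ), ∫ η in Ioi (0 : ℝ),
      (g + 1)⁻¹ * η * Fker p n g η w s * (hfun i η * hfunDeriv i η) * (g / (g + 1)) ^ b *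
        (kfun j g) ^ 2 := by
    refine integral_congr_ae (Filter.Eventually.of_forall fun g => ?_)
    refine setIntegral_congr_ae measurableSet_Ioi ?_
    filter_upwards [Measure.ae_ne volume (1 : ℝ)] with η h1 h0
    rw [(hhi' η h0 h1).unique (hasDerivAt_hfun hi h0 h1)]
  have e4 : (∫ g in Ioi (0 : ℝ), ∫ η in Ioi (0 : ℝ),
      (g + 1 + w) * Fker p n g η w s * (hfun i η) ^ 2 * (g / (g + 1)) ^ b *
        (kfun j g * kj' g)) = ∫ g in Ioi (0 : ℝ), ∫ η in Ioi (0 : ℝ),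
      (g + 1 + w) * Fker p n g η w s * (hfun i η) ^ 2 * (g / (g + 1)) ^ b *
        (kfun j g * kfunDeriv j g) := by
    refine setIntegral_congr_fun measurableSet_Ioi fun g hg => ?_
    have hg' : 0 ≤ g := (mem_Ioi.1 hg).le
    simp only [(hkj' g hg').unique (hasDerivAt_kfun hj hg')]
  have i0 := integrable_base hp n hb.le hw.le hs hi hj
  have i1 := integrable_inv_mul_base hp n hb.le hw.le hs hi hj
  have i2 := integrable_hfunDeriv_term hp n hb.le hw.le hs hi hj
  have i4 := integrable_kfunDeriv_term hp n hb.le hw.le hs hi hj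
  have i5 := integrable_prior_deriv_term hp n hb hw.le hs hi hj
  have i6 := integrable_exponent_term hp n hb.le hw.le hs hi hj
  rw [e2, e4, ← integral_prod _ i0, ← integral_prod _ i1, ← integral_prod _ i2,
    ← integral_prod _ i4, ← integral_prod _ i5]
  have iη := ((i1.const_mul (((p : ℝ) / 2 + (n : ℝ) / 2 + 1) * w)).add
    (i2.const_mul (2 * w))).sub i6
  have ig := ((((i0.const_mul (1 - (p : ℝ) / 2)).sub (i1.const_mul ((p : ℝ) / 2 * w))).add
    i6).add (i5.const_mul b)).add (i4.const_mul 2)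
  have hη := integral_prod _ iη
  rw [integral_eq_zero_of_ae (μ := volume.restrict (Ioi (0 : ℝ))) (by
    filter_upwards [iη.prod_right_ae, ae_restrict_mem measurableSet_Ioi] with g hint hg
    refine integral_eta_eq_zero (p := p) (n := n) hp hi hg hw.le hs
      (w / (g + 1) * (g / (g + 1)) ^ b * kfun j g ^ 2) (fun η _ => ?_) hint
    simp only [Pi.add_apply, Pi.sub_apply]
    ring)] at hη
  have hg := integral_prod_symm _ ig
  rw [integral_eq_zero_of_ae (μ := volume.restrict (Ioi (0 : ℝ))) (by
    filter_upwards [ig.prod_left_ae, ae_restrict_mem measurableSet_Ioi] with η hint hη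
    refine integral_g_eq_zero (p := p) (n := n) hp hj hb hη hw.le hs
      (hfun i η ^ 2) (fun g _ => ?_) hint
    simp only [Pi.add_apply, Pi.sub_apply]
    ring)] at hg
  rw [integral_sub' ((i1.const_mul _).add (i2.const_mul _)) i6,
    integral_add' (i1.const_mul _) (i2.const_mul _),
    integral_const_mul, integral_const_mul] at hη
  rw [integral_add' ((((i0.const_mul _).sub (i1.const_mul _)).add i6).add (i5.const_mul b))
      (i4.const_mul _),
    integral_add' (((i0.const_mul _).sub (i1.const_mul _)).add i6) (i5.const_mul b),
    integral_add' ((i0.const_mul _).sub (i1.const_mul _)) i6,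
    integral_sub' (i0.const_mul _) (i1.const_mul _),
    integral_const_mul, integral_const_mul, integral_const_mul, integral_const_mul] at hg
  linarith
end

section
/- Let p ≥ 1 be an integer and b > 0, and set π(g) = (g/(g+1))^b. Define r₁ = [∫_0^∞ ((g+1)/g) π(g) (g+1)^{-p/2-2} dg] / [∫_0^∞ π(g) (g+1)^{-p/2-2} dg], which is finite and positive. Then for every c ≥ 0, with G(g) = (g+1)^{-p/2} π(g) exp(-c/(g+1)): ∫_0^∞ G(g)/g dg ≤ r₁ ∫_0^∞ G(g)/(g+1) dg, and ∫_0^∞ G(g)/(g(g+1)) dg ≤ r₁ ∫_0^∞ G(g)/(g+1)² dg. -/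
open MeasureTheory Real Set

/-- The beta-prime weight `g ^ a * (g + 1) ^ (-s)` is integrable on the half-line. -/
theorem integrableOn_rpow_mul_add_one_rpow {a s : ℝ} (ha : -1 < a) (hs : a + 1 < s) :
    IntegrableOn (fun g : ℝ => g ^ a * (g + 1) ^ (-s)) (Ioi 0) := by
  have hm : Measurable fun g : ℝ => g ^ a * (g + 1) ^ (-s) := by fun_prop
  rw [← Ioc_union_Ioi_eq_Ioi (zero_le_one' ℝ)]
  refine IntegrableOn.union ?_ ?_
  · have h : IntegrableOn (fun g : ℝ => g ^ a) (Ioc 0 1) :=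
      (intervalIntegrable_iff_integrableOn_Ioc_of_le zero_le_one).1
        (intervalIntegral.intervalIntegrable_rpow' ha)
    refine Integrable.mono' h hm.aestronglyMeasurable ?_
    refine (ae_restrict_iff' measurableSet_Ioc).2 (.of_forall fun g hg => ?_)
    have hg0 : 0 < g := hg.1
    rw [Real.norm_of_nonneg (by positivity)]
    exact mul_le_of_le_one_right (by positivity)
      (Real.rpow_le_one_of_one_le_of_nonpos (by linarith) (by linarith))
  · have h : IntegrableOn (fun g : ℝ => g ^ (a - s)) (Ioi 1) :=
      integrableOn_Ioi_rpow_of_lt (by linarith) one_pos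
    refine Integrable.mono' h hm.aestronglyMeasurable ?_
    refine (ae_restrict_iff' measurableSet_Ioi).2 (.of_forall fun g hg => ?_)
    have hg0 : 0 < g := one_pos.trans hg
    rw [Real.norm_of_nonneg (by positivity), sub_eq_add_neg, Real.rpow_add hg0]
    gcongr ?_ * ?_
    exact Real.rpow_le_rpow_of_nonpos hg0 (by linarith) (by linarith)

/-- Splitting the power of a quotient in the weight `(g / (g + 1)) ^ b * (g + 1) ^ t`. -/
theorem div_add_one_rpow_mul {g : ℝ} (hg : 0 < g) (b t : ℝ) :
    (g / (g + 1)) ^ b * (g + 1) ^ t = g ^ b * (g + 1) ^ (-(b - t)) := by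
  have h : 0 < g + 1 := by linarith
  rw [Real.div_rpow hg.le h.le, neg_sub, Real.rpow_sub h]
  ring

theorem integrableOn_div_add_one_rpow_mul {b t : ℝ} (hb : -1 < b) (ht : t < -1) :
    IntegrableOn (fun g : ℝ => (g / (g + 1)) ^ b * (g + 1) ^ t) (Ioi 0) :=
  (integrableOn_rpow_mul_add_one_rpow hb (by linarith : b + 1 < b - t)).congr_fun
    (fun _ hg => (div_add_one_rpow_mul hg b t).symm) measurableSet_Ioi

theorem integrableOn_inv_mul_div_add_one_rpow_mul {b t : ℝ} (hb : 0 < b) (ht : t < -1) :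
    IntegrableOn (fun g : ℝ => ((g + 1) / g) * (g / (g + 1)) ^ b * (g + 1) ^ t) (Ioi 0) := by
  refine (integrableOn_div_add_one_rpow_mul (by linarith : -1 < b - 1) ht).congr_fun
    (fun g hg => ?_) measurableSet_Ioi
  have hg0 : 0 < g := hg
  have h : 0 < g / (g + 1) := by positivity
  simp only [Real.rpow_sub_one h.ne']
  field_simp

/-- If the mean of `(g + 1) / g` under the weight `w` is `r > 1`, then its mean under the weight
`w * φ` with `φ` increasing is at most `r`. -/
theorem setIntegral_add_one_div_mul_le {w φ : ℝ → ℝ} {r : ℝ} (hr : 1 < r)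
    (hw : ∀ g, 0 < g → 0 ≤ w g) (hφ : MonotoneOn φ (Ioi 0))
    (hwi : IntegrableOn w (Ioi 0))
    (hhwi : IntegrableOn (fun g => (g + 1) / g * w g) (Ioi 0))
    (hwφ : IntegrableOn (fun g => w g * φ g) (Ioi 0))
    (hhwφ : IntegrableOn (fun g => (g + 1) / g * (w g * φ g)) (Ioi 0))
    (hmean : ∫ g in Ioi (0 : ℝ), (g + 1) / g * w g = r * ∫ g in Ioi (0 : ℝ), w g) :
    ∫ g in Ioi (0 : ℝ), (g + 1) / g * (w g * φ g) ≤ r * ∫ g in Ioi (0 : ℝ), w g * φ g := by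
  set x : ℝ := 1 / (r - 1)
  have hx : 0 < x := one_div_pos.2 (by linarith)
  have hxr : x * (r - 1) = 1 := one_div_mul_cancel (by linarith)
  have key : ∫ g in Ioi (0 : ℝ), ((g + 1) / g * (w g * φ g) - r * (w g * φ g)) ≤
      ∫ g in Ioi (0 : ℝ), φ x * ((g + 1) / g * w g - r * w g) := by
    refine setIntegral_mono_on (hhwφ.sub (hwφ.const_mul r))
      ((hhwi.sub (hwi.const_mul r)).const_mul _) measurableSet_Ioi fun g hg => ?_
    have hg0 : 0 < g := hg
    have hfac : (g + 1) / g - r = (r - 1) * (x - g) / g := by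
      field_simp
      linarith
    have hsign : ((g + 1) / g - r) * (φ g - φ x) ≤ 0 := by
      rw [hfac]
      rcases le_total g x with h | h
      · exact mul_nonpos_of_nonneg_of_nonpos
          (div_nonneg (mul_nonneg (by linarith) (by linarith)) hg0.le)
          (sub_nonpos.2 (hφ hg hx h))
      · exact mul_nonpos_of_nonpos_of_nonneg
          (div_nonpos_of_nonpos_of_nonneg
            (mul_nonpos_of_nonneg_of_nonpos (by linarith) (by linarith)) hg0.le)
          (sub_nonneg.2 (hφ hx hg h))
    linarith [mul_nonpos_of_nonneg_of_nonpos (hw g hg0) hsign]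
  rw [integral_sub hhwφ (hwφ.const_mul r), integral_const_mul, integral_const_mul,
    integral_sub hhwi (hwi.const_mul r), integral_const_mul, hmean] at key
  linarith

theorem setIntegral_Ioi_pos {f : ℝ → ℝ} (hf : IntegrableOn f (Ioi 0))
    (hpos : ∀ g, 0 < g → 0 < f g) : 0 < ∫ g in Ioi (0 : ℝ), f g := by
  have hs : Ioi 0 ⊆ Function.support f := fun g hg => (hpos g hg).ne'
  rw [setIntegral_pos_iff_support_of_nonneg_ae
    ((ae_restrict_iff' measurableSet_Ioi).2 (.of_forall fun g hg => (hpos g hg).le)) hf,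
    inter_eq_right.2 hs]
  simp

theorem MeasureTheory.IntegrableOn.mul_exp_neg_div_add_one {f : ℝ → ℝ} (hf : IntegrableOn f (Ioi 0)) {c : ℝ}
    (hc : 0 ≤ c) : IntegrableOn (fun g => f g * Real.exp (-c / (g + 1))) (Ioi 0) := by
  have hm : Measurable fun g : ℝ => Real.exp (-c / (g + 1)) := by fun_prop
  refine Integrable.mono hf (hf.aestronglyMeasurable.mul hm.aestronglyMeasurable) ?_
  refine (ae_restrict_iff' measurableSet_Ioi).2 (.of_forall fun g hg => ?_)
  have hg0 : 0 < g := hg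
  rw [norm_mul, Real.norm_of_nonneg (Real.exp_pos _).le]
  refine mul_le_of_le_one_right (norm_nonneg _) (Real.exp_le_one_iff.2 ?_)
  exact div_nonpos_of_nonpos_of_nonneg (by linarith) (by linarith)

theorem monotoneOn_exp_neg_div_add_one {c : ℝ} (hc : 0 ≤ c) :
    MonotoneOn (fun g : ℝ => Real.exp (-c / (g + 1))) (Ioi 0) := by
  intro x hx y _ hxy
  have hx0 : 0 < x := hx
  refine Real.exp_le_exp.2 ?_
  rw [neg_div, neg_div, neg_le_neg_iff]
  gcongr

/-- Covariance-type inequalities replacing `1/g` by `1/(g+1)`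
(Lemma on `r₁`), for `π(g) = (g/(g+1))^b`. -/
theorem covariance_inequalities (p : ℕ) (hp : 1 ≤ p) (b : ℝ) (hb : 0 < b)
    (r1 : ℝ)
    (hr1 : r1 = (∫ g in Ioi (0 : ℝ),
        ((g + 1) / g) * (g / (g + 1)) ^ b * (g + 1) ^ (-(p : ℝ) / 2 - 2)) /
      (∫ g in Ioi (0 : ℝ), (g / (g + 1)) ^ b * (g + 1) ^ (-(p : ℝ) / 2 - 2))) :
    -- r₁ is finite (the defining integrals converge) and positive
    IntegrableOn (fun g : ℝ =>
        ((g + 1) / g) * (g / (g + 1)) ^ b * (g + 1) ^ (-(p : ℝ) / 2 - 2)) (Ioi 0) ∧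
    IntegrableOn (fun g : ℝ =>
        (g / (g + 1)) ^ b * (g + 1) ^ (-(p : ℝ) / 2 - 2)) (Ioi 0) ∧
    0 < r1 ∧
    -- the two inequalities, with G(g) = (g+1)^{-p/2} π(g) exp(-c/(g+1))
    (∀ c : ℝ, 0 ≤ c →
      (∫ g in Ioi (0 : ℝ),
          ((g + 1) ^ (-(p : ℝ) / 2) * (g / (g + 1)) ^ b * Real.exp (-c / (g + 1))) / g)
        ≤ r1 * ∫ g in Ioi (0 : ℝ),
          ((g + 1) ^ (-(p : ℝ) / 2) * (g / (g + 1)) ^ b * Real.exp (-c / (g + 1))) / (g + 1) ∧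
      (∫ g in Ioi (0 : ℝ),
          ((g + 1) ^ (-(p : ℝ) / 2) * (g / (g + 1)) ^ b * Real.exp (-c / (g + 1))) /
            (g * (g + 1)))
        ≤ r1 * ∫ g in Ioi (0 : ℝ),
          ((g + 1) ^ (-(p : ℝ) / 2) * (g / (g + 1)) ^ b * Real.exp (-c / (g + 1))) /
            (g + 1) ^ 2) := by
  have hp' : (1 : ℝ) ≤ p := by exact_mod_cast hp
  set t : ℝ := -(p : ℝ) / 2 with ht
  have hhw := integrableOn_inv_mul_div_add_one_rpow_mul hb (by linarith : t - 2 < -1)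
  have hw := integrableOn_div_add_one_rpow_mul (by linarith : -1 < b) (by linarith : t - 2 < -1)
  have hhw1 := integrableOn_inv_mul_div_add_one_rpow_mul hb (by linarith : t - 1 < -1)
  have hw1 := integrableOn_div_add_one_rpow_mul (by linarith : -1 < b) (by linarith : t - 1 < -1)
  have hwpos : ∀ g : ℝ, 0 < g → 0 < (g / (g + 1)) ^ b * (g + 1) ^ (t - 2) :=
    fun g hg => by positivity
  have hI := setIntegral_Ioi_pos hw hwpos
  have hlt : 0 < ∫ g in Ioi (0 : ℝ), (((g + 1) / g) * (g / (g + 1)) ^ b * (g + 1) ^ (t - 2) -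
      (g / (g + 1)) ^ b * (g + 1) ^ (t - 2)) := by
    refine setIntegral_Ioi_pos (hhw.sub hw) fun g hg => ?_
    have h1 : 1 < (g + 1) / g := by rw [one_lt_div hg]; linarith
    rw [mul_assoc]
    linarith [mul_lt_mul_of_pos_right h1 (hwpos g hg)]
  rw [integral_sub hhw hw, sub_pos] at hlt
  have hr : 1 < r1 := by rwa [hr1, one_lt_div hI]
  have hmean : ∫ g in Ioi (0 : ℝ), (g + 1) / g * ((g / (g + 1)) ^ b * (g + 1) ^ (t - 2)) =
      r1 * ∫ g in Ioi (0 : ℝ), (g / (g + 1)) ^ b * (g + 1) ^ (t - 2) := by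
    rw [hr1, div_mul_cancel₀ _ hI.ne']
    simp only [mul_assoc]
  have hhw' := hhw
  simp only [mul_assoc] at hhw'
  have hsub1 : ∀ g : ℝ, 0 < g → (g + 1) ^ (t - 1) = (g + 1) ^ t / (g + 1) :=
    fun g hg => Real.rpow_sub_one (by positivity) t
  have hsub2 : ∀ g : ℝ, 0 < g → (g + 1) ^ (t - 2) = (g + 1) ^ t / (g + 1) ^ 2 :=
    fun g hg => by exact_mod_cast Real.rpow_sub_natCast (by positivity : g + 1 ≠ 0) t 2
  refine ⟨hhw, hw, by linarith, fun c hc => ⟨?_, ?_⟩⟩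
  · have hleft : EqOn (fun g : ℝ =>
        ((g + 1) ^ t * (g / (g + 1)) ^ b * Real.exp (-c / (g + 1))) / g)
        (fun g => (g + 1) / g * (((g / (g + 1)) ^ b * (g + 1) ^ (t - 2)) *
          ((g + 1) * Real.exp (-c / (g + 1))))) (Ioi 0) := fun g hg => by
      have hg0 : 0 < g := hg
      simp only [hsub2 g hg0]
      field_simp
    have hright : EqOn (fun g : ℝ =>
        ((g + 1) ^ t * (g / (g + 1)) ^ b * Real.exp (-c / (g + 1))) / (g + 1))
        (fun g => ((g / (g + 1)) ^ b * (g + 1) ^ (t - 2)) *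
          ((g + 1) * Real.exp (-c / (g + 1)))) (Ioi 0) := fun g hg => by
      have hg0 : 0 < g := hg
      simp only [hsub2 g hg0]
      field_simp
    rw [setIntegral_congr_fun measurableSet_Ioi hleft,
      setIntegral_congr_fun measurableSet_Ioi hright]
    refine setIntegral_add_one_div_mul_le hr (fun g hg => (hwpos g hg).le) ?_ hw hhw' ?_ ?_ hmean
    · intro x hx y hy hxy
      have hy0 : 0 < y := hy
      exact mul_le_mul (by linarith) (monotoneOn_exp_neg_div_add_one hc hx hy hxy)
        (Real.exp_pos _).le (by linarith)
    · refine (hw1.mul_exp_neg_div_add_one hc).congr_fun (fun g hg => ?_) measurableSet_Ioi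
      have hg0 : 0 < g := hg
      simp only [hsub1 g hg0, hsub2 g hg0]
      field_simp
    · refine (hhw1.mul_exp_neg_div_add_one hc).congr_fun (fun g hg => ?_) measurableSet_Ioi
      have hg0 : 0 < g := hg
      simp only [hsub1 g hg0, hsub2 g hg0]
      field_simp
  · have hleft : EqOn (fun g : ℝ =>
        ((g + 1) ^ t * (g / (g + 1)) ^ b * Real.exp (-c / (g + 1))) / (g * (g + 1)))
        (fun g => (g + 1) / g * (((g / (g + 1)) ^ b * (g + 1) ^ (t - 2)) *
          Real.exp (-c / (g + 1)))) (Ioi 0) := fun g hg => by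
      have hg0 : 0 < g := hg
      simp only [hsub2 g hg0]
      field_simp
    have hright : EqOn (fun g : ℝ =>
        ((g + 1) ^ t * (g / (g + 1)) ^ b * Real.exp (-c / (g + 1))) / (g + 1) ^ 2)
        (fun g => ((g / (g + 1)) ^ b * (g + 1) ^ (t - 2)) *
          Real.exp (-c / (g + 1))) (Ioi 0) := fun g hg => by
      have hg0 : 0 < g := hg
      simp only [hsub2 g hg0]
      field_simp
    rw [setIntegral_congr_fun measurableSet_Ioi hleft,
      setIntegral_congr_fun measurableSet_Ioi hright]
    refine setIntegral_add_one_div_mul_le hr (fun g hg => (hwpos g hg).le)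
      (monotoneOn_exp_neg_div_add_one hc) hw hhw' (hw.mul_exp_neg_div_add_one hc) ?_ hmean
    simpa only [mul_assoc] using hhw.mul_exp_neg_div_add_one hc
end

section
/- Let p ≥ 1 and n ≥ 1 be integers and m a real with -n/2 < m < p/2+1. Let Π: (0,∞) → [0,∞) be measurable with ∫_0^∞ Π(g)/(g+1)^{m-1} dg < ∞. Then ∫_{ℝ^p}∫_0^∞∫_0^∞∫_0^∞ [‖x‖² s^{n/2-1} / (‖x‖²/s)^m] · F(g,η;‖x‖²/s,s) · Π(g) / (1+|log s|)² dg dη ds dx = 2·q₃(m) · ∫_0^∞ Π(g)/(g+1)^{m-1} dg, where q₃(m) = 2^{p/2+n/2+1} π^{p/2} Γ(p/2+1-m)Γ(n/2+m)/Γ(p/2). -/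
open MeasureTheory Real Set

/-- The constant `q₃(m)`. -/
noncomputable def q3 (p n : ℕ) (m : ℝ) : ℝ :=
  2 ^ ((p : ℝ) / 2 + (n : ℝ) / 2 + 1) * π ^ ((p : ℝ) / 2) *
    (Real.Gamma ((p : ℝ) / 2 + 1 - m) * Real.Gamma ((n : ℝ) / 2 + m)) /
    Real.Gamma ((p : ℝ) / 2)

lemma integral_toReal_iterated {α β γ δ : Type*} [MeasurableSpace α] [MeasurableSpace β]
    [MeasurableSpace γ] [MeasurableSpace δ] (μ : Measure α) (ν : Measure β) (ρ : Measure γ)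
    (τ : Measure δ) [SFinite ν] [SFinite ρ] [SFinite τ]
    {G : α × β × γ × δ → ENNReal} (hG : Measurable G) (hG' : ∀ z, G z < ⊤)
    (hfin : ∫⁻ x, ∫⁻ y, ∫⁻ z, ∫⁻ t, G (x, y, z, t) ∂τ ∂ρ ∂ν ∂μ < ⊤) :
    ∫ x, ∫ y, ∫ z, ∫ t, (G (x, y, z, t)).toReal ∂τ ∂ρ ∂ν ∂μ =
      (∫⁻ x, ∫⁻ y, ∫⁻ z, ∫⁻ t, G (x, y, z, t) ∂τ ∂ρ ∂ν ∂μ).toReal := by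
  have h3 : Measurable fun w : (α × β) × γ => ∫⁻ t, G (w.1.1, w.1.2, w.2, t) ∂τ :=
    Measurable.lintegral_prod_right' (f := fun q : ((α × β) × γ) × δ =>
      G (q.1.1.1, q.1.1.2, q.1.2, q.2)) (by fun_prop)
  have h2 : Measurable fun w : α × β => ∫⁻ z, ∫⁻ t, G (w.1, w.2, z, t) ∂τ ∂ρ :=
    Measurable.lintegral_prod_right' h3
  have h1 : Measurable fun x : α => ∫⁻ y, ∫⁻ z, ∫⁻ t, G (x, y, z, t) ∂τ ∂ρ ∂ν :=
    Measurable.lintegral_prod_right' h2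
  have hx := ae_lt_top h1 hfin.ne
  rw [← integral_toReal h1.aemeasurable hx]
  refine integral_congr_ae ?_
  filter_upwards [hx] with x hx
  have h2x : Measurable fun y : β => ∫⁻ z, ∫⁻ t, G (x, y, z, t) ∂τ ∂ρ :=
    h2.comp (measurable_const.prodMk measurable_id)
  have hy := ae_lt_top h2x hx.ne
  rw [← integral_toReal h2x.aemeasurable hy]
  refine integral_congr_ae ?_
  filter_upwards [hy] with y hy
  have h3x : Measurable fun z : γ => ∫⁻ t, G (x, y, z, t) ∂τ :=
    h3.comp (f := fun z : γ => ((x, y), z)) (by fun_prop)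
  rw [← integral_toReal h3x.aemeasurable (ae_lt_top h3x hy.ne)]
  refine integral_congr_ae (.of_forall fun z => ?_)
  exact integral_toReal (by fun_prop) (.of_forall fun t => hG' _)

lemma lintegral_iterated_rotate {α β γ δ : Type*} [MeasurableSpace α] [MeasurableSpace β]
    [MeasurableSpace γ] [MeasurableSpace δ] (μ : Measure α) (ν : Measure β) (ρ : Measure γ)
    (τ : Measure δ) [SFinite μ] [SFinite ν] [SFinite ρ] [SFinite τ]
    {G : α × β × γ × δ → ENNReal} (hG : Measurable G) :
    ∫⁻ x, ∫⁻ y, ∫⁻ z, ∫⁻ t, G (x, y, z, t) ∂τ ∂ρ ∂ν ∂μ =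
      ∫⁻ y, ∫⁻ z, ∫⁻ t, ∫⁻ x, G (x, y, z, t) ∂μ ∂τ ∂ρ ∂ν := by
  have h3 : Measurable fun w : (α × β) × γ => ∫⁻ t, G (w.1.1, w.1.2, w.2, t) ∂τ :=
    Measurable.lintegral_prod_right' (f := fun q : ((α × β) × γ) × δ =>
      G (q.1.1.1, q.1.1.2, q.1.2, q.2)) (by fun_prop)
  have h2 : Measurable fun w : α × β => ∫⁻ z, ∫⁻ t, G (w.1, w.2, z, t) ∂τ ∂ρ :=
    Measurable.lintegral_prod_right' h3
  rw [lintegral_lintegral_swap (f := fun x y => ∫⁻ z, ∫⁻ t, G (x, y, z, t) ∂τ ∂ρ)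
    h2.aemeasurable]
  refine lintegral_congr fun y => ?_
  rw [lintegral_lintegral_swap (f := fun x z => ∫⁻ t, G (x, y, z, t) ∂τ)]
  · refine lintegral_congr fun z => ?_
    exact lintegral_lintegral_swap (f := fun x t => G (x, y, z, t))
      (by unfold Function.uncurry; fun_prop)
  · exact (h3.comp (f := fun w : α × γ => ((w.1, y), w.2)) (by fun_prop)).aemeasurable

lemma lintegral_norm_rpow_mul_exp_neg_mul_sq {p : ℕ} (hp : 1 ≤ p) {m b : ℝ}
    (hm : m < (p : ℝ) / 2 + 1) (hb : 0 < b) :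
    ∫⁻ x : EuclideanSpace ℝ (Fin p), ENNReal.ofReal (‖x‖ ^ (2 - 2 * m) * exp (-b * ‖x‖ ^ 2)) =
      ENNReal.ofReal (π ^ ((p : ℝ) / 2) / Gamma ((p : ℝ) / 2) * Gamma ((p : ℝ) / 2 + 1 - m) *
        b ^ (-((p : ℝ) / 2 + 1 - m))) := by
  have : Nonempty (Fin p) := ⟨⟨0, hp⟩⟩
  have : Nontrivial (EuclideanSpace ℝ (Fin p)) := by
    apply Module.nontrivial_of_finrank_pos (R := ℝ)
    simp; omega
  have hp0 : (0 : ℝ) < p := by exact_mod_cast hp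
  have hq : -1 < (p : ℝ) + 1 - 2 * m := by linarith
  have key : EqOn (fun y : ℝ => y ^ ((p : ℝ) + 1 - 2 * m) * exp (-b * y ^ 2))
      (fun y : ℝ => y ^ (p - 1) • (y ^ (2 - 2 * m) * exp (-b * y ^ 2))) (Ioi 0) := by
    intro y hy
    have hy : 0 < y := hy
    simp only [smul_eq_mul]
    rw [← mul_assoc, ← rpow_natCast y (p - 1), ← rpow_add hy, Nat.cast_sub hp]
    congr 2
    push_cast
    ring
  rw [← ofReal_integral_eq_lintegral_ofReal]
  · congr 1
    rw [integral_fun_norm_addHaar volume (fun y : ℝ => y ^ (2 - 2 * m) * exp (-b * y ^ 2))]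
    simp only [finrank_euclideanSpace, Fintype.card_fin]
    rw [← setIntegral_congr_fun measurableSet_Ioi key]
    have := integral_rpow_mul_exp_neg_mul_rpow (p := 2) two_pos hq hb
    simp only [rpow_two] at this
    rw [this, measureReal_def, EuclideanSpace.volume_ball]
    have hG : 0 < Gamma ((p : ℝ) / 2) := Gamma_pos_of_pos (by positivity)
    have hs : √π ^ p = π ^ ((p : ℝ) / 2) := by
      rw [sqrt_eq_rpow, ← rpow_natCast, ← rpow_mul pi_pos.le]
      congr 1
      ring
    have e1 : ((p : ℝ) + 1 - 2 * m + 1) / 2 = (p : ℝ) / 2 + 1 - m := by ring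
    simp only [ENNReal.ofReal_one, one_pow, one_mul, Fintype.card_fin]
    rw [neg_div, e1, Gamma_add_one (by positivity), ENNReal.toReal_ofReal (by positivity), hs]
    simp only [nsmul_eq_mul, smul_eq_mul]
    field_simp
  · rw [integrable_fun_norm_addHaar volume
      (f := fun y : ℝ => y ^ (2 - 2 * m) * exp (-b * y ^ 2))]
    simp only [finrank_euclideanSpace, Fintype.card_fin]
    exact (integrableOn_rpow_mul_exp_neg_mul_sq hb hq).congr_fun key measurableSet_Ioi
  · exact .of_forall fun x => by positivity

lemma lintegral_rpow_mul_exp_neg_mul {a r : ℝ} (ha : 0 < a) (hr : 0 < r) :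
    ∫⁻ t in Ioi (0 : ℝ), ENNReal.ofReal (t ^ (a - 1) * exp (-r * t)) =
      ENNReal.ofReal ((1 / r) ^ a * Gamma a) := by
  rw [← ofReal_integral_eq_lintegral_ofReal]
  · rw [← integral_rpow_mul_exp_neg_mul_Ioi ha hr]
    simp only [neg_mul]
  · simpa only [rpow_one, IntegrableOn] using
      integrableOn_rpow_mul_exp_neg_mul_rpow (p := 1) (s := a - 1) (b := r) (by linarith) one_pos hr
  · exact (ae_restrict_iff' measurableSet_Ioi).2 (.of_forall fun t (ht : 0 < t) => by positivity)

lemma lintegral_inv_mul_inv_one_add_abs_log_sq :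
    ∫⁻ s in Ioi (0 : ℝ), ENNReal.ofReal (s⁻¹ * ((1 + |log s|) ^ 2)⁻¹) = 2 := by
  have hI : IntegrableOn (fun u : ℝ => ((1 + u) ^ 2)⁻¹) (Ioi 0) ∧
      ∫ u in Ioi (0 : ℝ), ((1 + u) ^ 2)⁻¹ = 1 := by
    have hd : ∀ x ∈ Ici (0 : ℝ),
        HasDerivAt (fun u : ℝ => -(1 + u)⁻¹) (((1 + x) ^ 2)⁻¹) x := by
      intro x hx
      have hx : 0 ≤ x := hx
      have h := (((hasDerivAt_id x).const_add 1).inv (by simp only [id]; positivity)).neg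
      convert! h using 1
      simp [neg_div]
    have ht : Filter.Tendsto (fun u : ℝ => -(1 + u)⁻¹) Filter.atTop (nhds 0) := by
      simpa using (tendsto_inv_atTop_zero.comp
        (Filter.tendsto_atTop_add_const_left Filter.atTop (1 : ℝ) Filter.tendsto_id)).neg
    have hpos : ∀ x ∈ Ioi (0 : ℝ), 0 ≤ ((1 + x) ^ 2)⁻¹ := fun x _ => by positivity
    refine ⟨integrableOn_Ioi_deriv_of_nonneg' hd hpos ht, ?_⟩
    rw [integral_Ioi_of_hasDerivAt_of_nonneg' hd hpos ht]
    simp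
  have h := lintegral_image_eq_lintegral_abs_deriv_mul (s := univ) (f := exp) (f' := exp)
    MeasurableSet.univ (fun x _ => (hasDerivAt_exp x).hasDerivWithinAt) exp_injective.injOn
    (fun s => ENNReal.ofReal (s⁻¹ * ((1 + |log s|) ^ 2)⁻¹))
  rw [image_univ, range_exp] at h
  rw [h, Measure.restrict_univ]
  have h2 : ∀ u : ℝ, ENNReal.ofReal |exp u| *
      ENNReal.ofReal ((exp u)⁻¹ * ((1 + |log (exp u)|) ^ 2)⁻¹) =
      ENNReal.ofReal (((1 + |u|) ^ 2)⁻¹) := by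
    intro u
    rw [← ENNReal.ofReal_mul (abs_nonneg _), abs_of_pos (exp_pos u), log_exp, ← mul_assoc,
      mul_inv_cancel₀ (exp_pos u).ne', one_mul]
  simp_rw [h2]
  rw [← ofReal_integral_eq_lintegral_ofReal, integral_comp_abs (f := fun u => ((1 + u) ^ 2)⁻¹),
    hI.2]
  · simp
  · have := integrable_one_add_norm (E := ℝ) (μ := volume) (r := 2) (by simp)
    refine this.congr (.of_forall fun u => ?_)
    simp only [norm_eq_abs]
    rw [rpow_neg (by positivity), rpow_two]
  · exact .of_forall fun u => by positivity

lemma integrand_eq_mul {p n : ℕ} {m r s η g : ℝ} (c : ℝ) (hr : 0 < r) (hs : 0 < s) (hg : 0 < g) :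
    (r ^ 2 * s ^ ((n : ℝ) / 2 - 1) / (r ^ 2 / s) ^ m) * Fker p n g η (r ^ 2 / s) s * c /
        (1 + |log s|) ^ 2 =
      (s ^ ((n : ℝ) / 2 + m - 1) * ((1 + |log s|) ^ 2)⁻¹) *
        (η ^ ((p : ℝ) / 2 + (n : ℝ) / 2) * exp (-(s / 2) * η)) *
        (c * (g + 1) ^ (-(p : ℝ) / 2)) *
        (r ^ (2 - 2 * m) * exp (-(η / (2 * (g + 1))) * r ^ 2)) := by
  have hg1 : 0 < g + 1 := by linarith
  have e1 : r ^ 2 * s ^ ((n : ℝ) / 2 - 1) / (r ^ 2 / s) ^ m =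
      s ^ ((n : ℝ) / 2 + m - 1) * r ^ (2 - 2 * m) := by
    rw [div_rpow (by positivity) hs.le, ← rpow_two, ← rpow_mul hr.le, rpow_sub hr,
      show (n : ℝ) / 2 + m - 1 = ((n : ℝ) / 2 - 1) + m by ring, rpow_add hs]
    field_simp
  have e2 : exp (-(η * s / 2) * (r ^ 2 / s / (g + 1) + 1)) =
      exp (-(s / 2) * η) * exp (-(η / (2 * (g + 1))) * r ^ 2) := by
    rw [← exp_add]
    congr 1
    field_simp
    ring
  rw [e1, Fker, e2]
  ring

lemma lintegral_integrand {p n : ℕ} (hp : 1 ≤ p) {m s η g : ℝ} (hm : m < (p : ℝ) / 2 + 1)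
    {c : ℝ} (hs : 0 < s) (hη : 0 < η) (hg : 0 < g) (hc : 0 ≤ c) :
    ∫⁻ x : EuclideanSpace ℝ (Fin p), ENNReal.ofReal
      ((‖x‖ ^ 2 * s ^ ((n : ℝ) / 2 - 1) / (‖x‖ ^ 2 / s) ^ m) *
            Fker p n g η (‖x‖ ^ 2 / s) s * c / (1 + |log s|) ^ 2) =
      ENNReal.ofReal (π ^ ((p : ℝ) / 2) / Gamma ((p : ℝ) / 2) * Gamma ((p : ℝ) / 2 + 1 - m) *
        2 ^ ((p : ℝ) / 2 + 1 - m) * (s ^ ((n : ℝ) / 2 + m - 1) * ((1 + |log s|) ^ 2)⁻¹)) *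
      (ENNReal.ofReal (η ^ ((n : ℝ) / 2 + m - 1) * exp (-(s / 2) * η)) *
        ENNReal.ofReal (c / (g + 1) ^ (m - 1))) := by
  have : Nontrivial (EuclideanSpace ℝ (Fin p)) := by
    apply Module.nontrivial_of_finrank_pos (R := ℝ)
    simp; omega
  have hg1 : 0 < g + 1 := by linarith
  have hp0 : (0 : ℝ) < p := by exact_mod_cast hp
  have hG : 0 < Gamma ((p : ℝ) / 2) := Gamma_pos_of_pos (by positivity)
  have hG' : 0 < Gamma ((p : ℝ) / 2 + 1 - m) := Gamma_pos_of_pos (by linarith)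
  set A := (s ^ ((n : ℝ) / 2 + m - 1) * ((1 + |log s|) ^ 2)⁻¹) *
        (η ^ ((p : ℝ) / 2 + (n : ℝ) / 2) * exp (-(s / 2) * η)) *
        (c * (g + 1) ^ (-(p : ℝ) / 2)) with hA
  have hA0 : 0 ≤ A := by positivity
  have step : ∀ᵐ x : EuclideanSpace ℝ (Fin p), ENNReal.ofReal
      ((‖x‖ ^ 2 * s ^ ((n : ℝ) / 2 - 1) / (‖x‖ ^ 2 / s) ^ m) *
            Fker p n g η (‖x‖ ^ 2 / s) s * c / (1 + |log s|) ^ 2) =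
      ENNReal.ofReal A * ENNReal.ofReal
        (‖x‖ ^ (2 - 2 * m) * exp (-(η / (2 * (g + 1))) * ‖x‖ ^ 2)) := by
    filter_upwards [Measure.ae_ne volume (0 : EuclideanSpace ℝ (Fin p))] with x hx
    rw [integrand_eq_mul c (norm_pos_iff.2 hx) hs hg, ENNReal.ofReal_mul hA0]
  rw [lintegral_congr_ae step, lintegral_const_mul _ (by fun_prop),
    lintegral_norm_rpow_mul_exp_neg_mul_sq hp hm (by positivity),
    ← ENNReal.ofReal_mul hA0, ← ENNReal.ofReal_mul (by positivity),
    ← ENNReal.ofReal_mul (by positivity)]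
  congr 1
  have e1 : (η / (2 * (g + 1))) ^ (-((p : ℝ) / 2 + 1 - m)) =
      η ^ (-((p : ℝ) / 2 + 1 - m)) * 2 ^ ((p : ℝ) / 2 + 1 - m) *
        (g + 1) ^ ((p : ℝ) / 2 + 1 - m) := by
    rw [div_rpow hη.le (by positivity), rpow_neg (by positivity : 0 ≤ 2 * (g + 1)), div_inv_eq_mul,
      mul_rpow two_pos.le hg1.le, mul_assoc]
  have e2 : η ^ ((n : ℝ) / 2 + m - 1) =
      η ^ ((p : ℝ) / 2 + (n : ℝ) / 2) * η ^ (-((p : ℝ) / 2 + 1 - m)) := by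
    rw [← rpow_add hη]
    congr 1
    ring
  have e3 : c / (g + 1) ^ (m - 1) =
      c * (g + 1) ^ (-(p : ℝ) / 2) * (g + 1) ^ ((p : ℝ) / 2 + 1 - m) := by
    rw [mul_assoc, ← rpow_add hg1, div_eq_mul_inv, ← rpow_neg hg1.le]
    congr 2
    ring
  rw [hA, e1, e2, e3]
  ring

lemma setLIntegral_congr_Ioi {f h : ℝ → ENNReal} (hfh : ∀ t, 0 < t → f t = h t) :
    ∫⁻ t in Ioi (0 : ℝ), f t = ∫⁻ t in Ioi (0 : ℝ), h t :=
  setLIntegral_congr_fun measurableSet_Ioi fun t ht => hfh t ht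

/-- Main integral identity with the extra factor `(1+|log s|)⁻²`
(Lemma B.2 of the paper). -/
theorem main_integral_identity_log (p n : ℕ) (hp : 1 ≤ p) (hn : 1 ≤ n) (m : ℝ)
    (hm1 : -(n : ℝ) / 2 < m) (hm2 : m < (p : ℝ) / 2 + 1)
    (Pf : ℝ → ℝ) (hPmeas : Measurable Pf) (hPpos : ∀ g : ℝ, 0 < g → 0 ≤ Pf g)
    (hPint : IntegrableOn (fun g : ℝ => Pf g / (g + 1) ^ (m - 1)) (Ioi 0)) :
    (∫ x : EuclideanSpace ℝ (Fin p), ∫ s in Ioi (0 : ℝ), ∫ η in Ioi (0 : ℝ),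
        ∫ g in Ioi (0 : ℝ),
          (‖x‖ ^ 2 * s ^ ((n : ℝ) / 2 - 1) / (‖x‖ ^ 2 / s) ^ m) *
            Fker p n g η (‖x‖ ^ 2 / s) s * Pf g / (1 + |Real.log s|) ^ 2)
      = 2 * q3 p n m * (∫ g in Ioi (0 : ℝ), Pf g / (g + 1) ^ (m - 1)) := by
  have hp0 : (0 : ℝ) < p := by exact_mod_cast hp
  have hG : 0 < Gamma ((p : ℝ) / 2) := Gamma_pos_of_pos (by positivity)
  have hG' : 0 < Gamma ((p : ℝ) / 2 + 1 - m) := Gamma_pos_of_pos (by linarith)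
  have hGn : 0 < Gamma ((n : ℝ) / 2 + m) := Gamma_pos_of_pos (by linarith)
  set I := ∫ g in Ioi (0 : ℝ), Pf g / (g + 1) ^ (m - 1) with hI
  have hPnn : ∀ g ∈ Ioi (0 : ℝ), 0 ≤ Pf g / (g + 1) ^ (m - 1) := fun g (hg : 0 < g) =>
    div_nonneg (hPpos g hg) (by positivity)
  have hI0 : 0 ≤ I := setIntegral_nonneg measurableSet_Ioi hPnn
  have hIl : ∫⁻ g in Ioi (0 : ℝ), ENNReal.ofReal (Pf g / (g + 1) ^ (m - 1)) =
      ENNReal.ofReal I :=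
    (ofReal_integral_eq_lintegral_ofReal hPint
      ((ae_restrict_iff' measurableSet_Ioi).2 (.of_forall hPnn))).symm
  set G : EuclideanSpace ℝ (Fin p) × ℝ × ℝ × ℝ → ENNReal := fun z => ENNReal.ofReal
    ((‖z.1‖ ^ 2 * z.2.1 ^ ((n : ℝ) / 2 - 1) / (‖z.1‖ ^ 2 / z.2.1) ^ m) *
      Fker p n z.2.2.2 z.2.2.1 (‖z.1‖ ^ 2 / z.2.1) z.2.1 * Pf z.2.2.2 /
        (1 + |Real.log z.2.1|) ^ 2)
  have hGm : Measurable G := by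
    unfold G Fker
    fun_prop
  have hval : ∫⁻ x, ∫⁻ s in Ioi (0 : ℝ), ∫⁻ η in Ioi (0 : ℝ), ∫⁻ g in Ioi (0 : ℝ),
      G (x, s, η, g) = ENNReal.ofReal (2 * q3 p n m * I) := by
    set K := π ^ ((p : ℝ) / 2) / Gamma ((p : ℝ) / 2) * Gamma ((p : ℝ) / 2 + 1 - m) *
        2 ^ ((p : ℝ) / 2 + 1 - m) with hK
    have hK0 : 0 ≤ K := by positivity
    have inner : ∀ s : ℝ, 0 < s → ∫⁻ η in Ioi (0 : ℝ), ∫⁻ g in Ioi (0 : ℝ), ∫⁻ x,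
        G (x, s, η, g) = ENNReal.ofReal
          (K * 2 ^ ((n : ℝ) / 2 + m) * Gamma ((n : ℝ) / 2 + m) * I) *
          ENNReal.ofReal (s⁻¹ * ((1 + |log s|) ^ 2)⁻¹) := by
      intro s hs
      have hη : ∀ η : ℝ, 0 < η → ∫⁻ g in Ioi (0 : ℝ), ∫⁻ x, G (x, s, η, g) =
          ENNReal.ofReal (K * (s ^ ((n : ℝ) / 2 + m - 1) * ((1 + |log s|) ^ 2)⁻¹)) *
            ENNReal.ofReal I *
            ENNReal.ofReal (η ^ ((n : ℝ) / 2 + m - 1) * exp (-(s / 2) * η)) := by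
        intro η hη
        rw [setLIntegral_congr_Ioi fun g hg =>
          lintegral_integrand hp hm2 hs hη hg (hPpos g hg),
          lintegral_const_mul _ (by fun_prop), lintegral_const_mul _ (by fun_prop), hIl]
        ring
      rw [setLIntegral_congr_Ioi hη, lintegral_const_mul _ (by fun_prop),
        lintegral_rpow_mul_exp_neg_mul (by linarith) (by positivity),
        ← ENNReal.ofReal_mul (by positivity), ← ENNReal.ofReal_mul (by positivity),
        ← ENNReal.ofReal_mul (by positivity)]
      congr 1
      rw [one_div_div, div_rpow two_pos.le hs.le, rpow_sub hs, rpow_one]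
      field_simp
    rw [lintegral_iterated_rotate _ _ _ _ hGm, setLIntegral_congr_Ioi inner,
      lintegral_const_mul _ (by fun_prop), lintegral_inv_mul_inv_one_add_abs_log_sq,
      ← ENNReal.ofReal_ofNat 2, ← ENNReal.ofReal_mul (by positivity)]
    congr 1
    rw [hK, q3, show (p : ℝ) / 2 + (n : ℝ) / 2 + 1 =
      ((p : ℝ) / 2 + 1 - m) + ((n : ℝ) / 2 + m) by ring,
      rpow_add two_pos ((p : ℝ) / 2 + 1 - m)]
    ring
  have hq0 : 0 ≤ q3 p n m := by unfold q3; positivity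
  have h := integral_toReal_iterated volume (volume.restrict (Ioi (0 : ℝ)))
    (volume.restrict (Ioi (0 : ℝ))) (volume.restrict (Ioi (0 : ℝ))) hGm
    (fun _ => ENNReal.ofReal_lt_top) (hval ▸ ENNReal.ofReal_lt_top)
  rw [hval, ENNReal.toReal_ofReal (by positivity)] at h
  rw [← h]
  refine integral_congr_ae (.of_forall fun x => ?_)
  refine setIntegral_congr_fun measurableSet_Ioi fun s (hs : 0 < s) => ?_
  refine setIntegral_congr_fun measurableSet_Ioi fun η (hη : 0 < η) => ?_
  refine setIntegral_congr_fun measurableSet_Ioi fun g (hg : 0 < g) => ?_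
  have := hPpos g hg
  refine (ENNReal.toReal_ofReal ?_).symm
  unfold Fker
  positivity
end
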